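/- The symmetries of Out(F) form a single conjugacy class of Out(F), and this class is anti-commutative: no two distinct symmetries of Out(F) commute in Out(F). -/

import Mathlib

open Pointwise

/-- A subset `S` of a free group is a basis if the canonical homomorphism
`FreeGroup S →* FreeGroup X` extending the inclusion is bijective. -/
def FreeGroup.IsBasis {X : Type*} (S : Set (FreeGroup X)) : Prop :=
  Function.Bijective (FreeGroup.lift (fun s : S => (s : FreeGroup X)))

/-- The subgroup of inner automorphisms of a group `G`, as a subgroup of `MulAut G`. -/
def Inn (G : Type*) [Group G] : Subgroup (MulAut G) :=
  (MulAut.conj : G →* MulAut G).range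

instance Inn.normal (G : Type*) [Group G] : (Inn G).Normal := by
  constructor
  rintro - ⟨g, rfl⟩ σ
  refine ⟨σ g, ?_⟩
  ext x
  simp [MulAut.conj, MulAut.mul_apply, mul_assoc]

/-- The outer automorphism group `Out G = Aut G / Inn G`. -/
abbrev OutAut (G : Type*) [Group G] := MulAut G ⧸ Inn G

/-- The natural homomorphism `Aut G → Out G`. -/
def toOut {G : Type*} [Group G] : MulAut G →* OutAut G :=
  QuotientGroup.mk' (Inn G)

/-- `g` is an involution of the group `G`. -/
def IsInvolution {G : Type*} [Group G] (g : G) : Prop :=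
  g ≠ 1 ∧ g ^ 2 = 1

/-- A subset of a group is anti-commutative if its elements pairwise do not commute. -/
def AntiCommSet {G : Type*} [Group G] (s : Set G) : Prop :=
  ∀ a ∈ s, ∀ b ∈ s, a ≠ b → a * b ≠ b * a

/-- A decomposition `U ⊔ S ⊔ ⊔_{x ∈ S} Y x` of a basis of a free group. -/
structure IsBasisDecomposition {X : Type*} (U S : Set (FreeGroup X))
    (Y : FreeGroup X → Set (FreeGroup X)) : Prop where
  isBasis : FreeGroup.IsBasis (U ∪ S ∪ ⋃ x ∈ S, Y x)
  disjUS : Disjoint U S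
  disjUY : ∀ x ∈ S, Disjoint U (Y x)
  disjSY : ∀ x ∈ S, Disjoint S (Y x)
  disjYY : ∀ x ∈ S, ∀ x' ∈ S, x ≠ x' → Disjoint (Y x) (Y x')

/-- `U ⊔ S ⊔ ⊔_{x ∈ S} Y x` is a canonical basis for the (soft) involution `φ`:
`φ` fixes `U` pointwise, inverts the elements of `S` and conjugates the elements of
`Y x` by `x`. -/
def IsCanonicalBasis {X : Type*} (φ : MulAut (FreeGroup X)) (U S : Set (FreeGroup X))
    (Y : FreeGroup X → Set (FreeGroup X)) : Prop :=
  IsBasisDecomposition U S Y ∧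
    (∀ u ∈ U, φ u = u) ∧ (∀ x ∈ S, φ x = x⁻¹) ∧
    (∀ x ∈ S, ∀ y ∈ Y x, φ y = x * y * x⁻¹)

/-- A soft involution of `Aut F`: an involution admitting a canonical basis. -/
def IsSoftInvolution {X : Type*} (φ : MulAut (FreeGroup X)) : Prop :=
  IsInvolution φ ∧ ∃ U S Y, IsCanonicalBasis φ U S Y

/-- A soft involution of `Out F`: an involution induced by a soft involution of `Aut F`. -/
def IsSoftOutInvolution {X : Type*} (f : OutAut (FreeGroup X)) : Prop :=
  IsInvolution f ∧ ∃ φ, IsSoftInvolution φ ∧ toOut φ = f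

/-- A `1`-involution of `Aut F`: a soft involution whose canonical bases have exactly
one block. -/
def IsOneInvolution {X : Type*} (ψ : MulAut (FreeGroup X)) : Prop :=
  IsInvolution ψ ∧ ∃ (U Y : Set (FreeGroup X)) (x : FreeGroup X),
    IsCanonicalBasis ψ U {x} (fun _ => Y)

/-- A `1`-involution of `Out F`: an involution induced by a `1`-involution of `Aut F`. -/
def IsOneOutInvolution {X : Type*} (f : OutAut (FreeGroup X)) : Prop :=
  IsInvolution f ∧ ∃ ψ, IsOneInvolution ψ ∧ toOut ψ = f

/-- An extremal involution of `Aut F`: an involution inverting one element of a suitable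
basis and fixing all other elements of that basis. -/
def IsExtremalInvolution {X : Type*} (φ : MulAut (FreeGroup X)) : Prop :=
  IsInvolution φ ∧ ∃ (B : Set (FreeGroup X)) (x : FreeGroup X),
    FreeGroup.IsBasis B ∧ x ∈ B ∧ φ x = x⁻¹ ∧ ∀ b ∈ B, b ≠ x → φ b = b

/-- An extremal involution of `Out F`: an involution induced by an extremal involution
of `Aut F`. -/
def IsExtremalOutInvolution {X : Type*} (f : OutAut (FreeGroup X)) : Prop :=
  IsInvolution f ∧ ∃ φ, IsExtremalInvolution φ ∧ toOut φ = f

/-- A symmetry of `Aut F`: an involution inverting all elements of some basis. -/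
def IsSymmetryAut {X : Type*} (θ : MulAut (FreeGroup X)) : Prop :=
  IsInvolution θ ∧ ∃ B : Set (FreeGroup X), FreeGroup.IsBasis B ∧ ∀ b ∈ B, θ b = b⁻¹

/-- A symmetry of `Out F`: an involution whose full preimage in `Aut F` contains a
symmetry. -/
def IsSymmetryOut {X : Type*} (f : OutAut (FreeGroup X)) : Prop :=
  IsInvolution f ∧ ∃ θ, IsSymmetryAut θ ∧ toOut θ = f

/-- Condition (★): the product set `K·K` contains exactly one conjugacy class of
involutions, and no element of `K` is a square. -/
def StarCondition {G : Type*} [Group G] (K : Set G) : Prop :=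
  (∃ c ∈ K * K, IsInvolution c ∧ ∀ d ∈ K * K, IsInvolution d → IsConj c d) ∧
    ∀ k ∈ K, ¬ ∃ g : G, g ^ 2 = k

namespace FreeGroup

section Flip

variable {X : Type*}

/-- The automorphism of `FreeGroup X` inverting all the standard generators. -/
def flip (X : Type*) : MulAut (FreeGroup X) :=
  MonoidHom.toMulEquiv (lift fun x => (of x)⁻¹) (lift fun x => (of x)⁻¹)
    (by ext x; simp) (by ext x; simp)

@[simp]
theorem flip_of (x : X) : flip X (of x) = (of x)⁻¹ := by
  simp [flip]

@[simp]
theorem flip_flip (g : FreeGroup X) : flip X (flip X g) = g :=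
  (flip X).symm_apply_apply g

theorem flip_mul_flip : flip X * flip X = 1 := by
  ext g
  simp

theorem flip_mk (L : List (X × Bool)) :
    flip X (mk L) = mk (L.map fun p => (p.1, !p.2)) := by
  induction L with
  | nil => exact _root_.map_one _
  | cons p L ih =>
    have h (q : X × Bool) (M : List (X × Bool)) : mk (q :: M) = mk [q] * mk M := rfl
    rw [List.map_cons, h, _root_.map_mul, ih, h (p.1, !p.2)]
    congr 1
    rcases p with ⟨x, _ | _⟩
    · change flip X (of x)⁻¹ = of x
      simp
    · exact flip_of x

theorem toWord_flip [DecidableEq X] (g : FreeGroup X) :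
    (flip X g).toWord = g.toWord.map fun p => (p.1, !p.2) := by
  conv_lhs => rw [← mk_toWord (x := g), flip_mk, toWord_mk]
  apply IsReduced.reduce_eq
  have h : IsReduced g.toWord := isReduced_toWord
  simpa [IsReduced, List.isChain_map] using h

theorem eq_one_of_flip_eq {g : FreeGroup X} (h : flip X g = g) : g = 1 := by
  classical
  have h' := toWord_flip g
  rw [h] at h'
  rw [← toWord_eq_nil_iff]
  cases hL : g.toWord with
  | nil => rfl
  | cons p L =>
    rw [hL, List.map_cons, List.cons.injEq] at h'
    exact absurd (congrArg Prod.snd h'.1) (by simp)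

/-- The elements sent by `flip` to their inverses are the palindromes. -/
theorem exists_eq_of_mul_flip_eq_one {d : FreeGroup X} (h : d * flip X d = 1) :
    ∃ w, d = w * (flip X w)⁻¹ ∨ ∃ x, d = w * of x * (flip X w)⁻¹ ∨
      d = w * (of x)⁻¹ * (flip X w)⁻¹ := by
  classical
  have hpal : List.Palindrome d.toWord := by
    have h₁ : flip X d = d⁻¹ := (inv_eq_of_mul_eq_one_right h).symm
    have h₂ := congrArg toWord h₁
    rw [toWord_flip, toWord_inv, invRev] at h₂
    have h₃ := (List.Palindrome.of_reverse_eq h₂.symm).map fun p : X × Bool => (p.1, !p.2)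
    simpa [Function.comp_def] using h₃
  rw [← mk_toWord (x := d)]
  generalize d.toWord = L at hpal
  induction hpal with
  | nil => exact ⟨1, Or.inl (by simp [← one_eq_mk])⟩
  | singleton p =>
    rcases p with ⟨x, _ | _⟩
    · refine ⟨1, Or.inr ⟨x, Or.inr ?_⟩⟩
      simp only [one_mul, _root_.map_one, inv_one, mul_one]
      rfl
    · refine ⟨1, Or.inr ⟨x, Or.inl ?_⟩⟩
      simp only [one_mul, _root_.map_one, inv_one, mul_one]
      rfl
  | @cons_concat p L _ ih =>
    have hsplit : mk (p :: (L ++ [p])) = mk [p] * mk L * mk [p] := rfl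
    have hp : (flip X (mk [p]))⁻¹ = mk [p] := by
      rw [flip_mk, inv_mk]
      simp [invRev]
    obtain ⟨w, hw | ⟨x, hw | hw⟩⟩ := ih
    · exact ⟨mk [p] * w, Or.inl (by rw [hsplit, hw, _root_.map_mul, mul_inv_rev, hp]; group)⟩
    · exact ⟨mk [p] * w, Or.inr ⟨x, Or.inl (by
        rw [hsplit, hw, _root_.map_mul, mul_inv_rev, hp]; group)⟩⟩
    · exact ⟨mk [p] * w, Or.inr ⟨x, Or.inr (by
        rw [hsplit, hw, _root_.map_mul, mul_inv_rev, hp]; group)⟩⟩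

theorem eq_one_of_conj_eq_one [Infinite X] {g : FreeGroup X} (h : MulAut.conj g = 1) :
    g = 1 := by
  classical
  obtain ⟨x, hx⟩ := Infinite.exists_notMem_finset (g.toWord.map Prod.fst).toFinset
  have hx' : ∀ p ∈ g.toWord, p.1 ≠ x := by
    intro p hp hpx
    exact hx (List.mem_toFinset.mpr (hpx ▸ List.mem_map_of_mem hp))
  have hcomm : g * of x = of x * g := by
    have h₁ := DFunLike.congr_fun h (of x)
    rw [MulAut.conj_apply, MulAut.one_apply] at h₁
    exact mul_inv_eq_iff_eq_mul.mp h₁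
  have hred : IsReduced g.toWord := isReduced_toWord
  have hl : IsReduced ((x, true) :: g.toWord) := by
    refine List.IsChain.cons hred fun p hp hpx => ?_
    exact absurd hpx.symm (hx' p (List.mem_of_mem_head? hp))
  have hr : IsReduced (g.toWord ++ [(x, true)]) := by
    refine List.IsChain.append hred (List.isChain_singleton _) fun p hp q hq hpq => ?_
    obtain rfl : (x, true) = q := by simpa using hq
    exact absurd hpq (hx' p (List.mem_of_mem_getLast? hp))
  have hw := congrArg toWord hcomm
  rw [toWord_mul, toWord_mul, toWord_of, hr.reduce_eq, List.singleton_append, hl.reduce_eq] at hw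
  rw [← toWord_eq_nil_iff]
  cases hL : g.toWord with
  | nil => rfl
  | cons p L =>
    rw [hL, List.cons_append, List.cons.injEq] at hw
    exact absurd (congrArg Prod.fst hw.1) (hx' p (by simp [hL]))

end Flip

section Magnus

variable {X : Type*}

open Classical in
/-- The operator on functions of words which moves the value at a word `l` to the word `x :: l`
if `l` does not start with `x`, and discards it otherwise. -/
noncomputable def prependOp (x : X) : Module.End ℚ (List X → ℚ) where
  toFun u
    | [] => 0
    | y :: l => if y = x ∧ l.head? ≠ some x then u l else 0
  map_add' u v := by
    funext l
    cases l with
    | nil => simp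
    | cons y l => by_cases h : y = x ∧ l.head? ≠ some x <;> simp [h]
  map_smul' c u := by
    funext l
    cases l with
    | nil => simp
    | cons y l => by_cases h : y = x ∧ l.head? ≠ some x <;> simp [h]

@[simp]
theorem prependOp_nil (x : X) (u : List X → ℚ) : prependOp x u [] = 0 :=
  rfl

open Classical in
theorem prependOp_cons (x y : X) (u : List X → ℚ) (l : List X) :
    prependOp x u (y :: l) = if y = x ∧ l.head? ≠ some x then u l else 0 :=
  rfl

theorem prependOp_mul_self (x : X) : prependOp x * prependOp x = 0 := by
  refine LinearMap.ext fun u => funext fun l => ?_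
  rcases l with _ | ⟨y, _ | ⟨z, l⟩⟩
  · rfl
  · simp only [Module.End.mul_apply, prependOp_cons, prependOp_nil, ite_self]
    rfl
  · change prependOp x (prependOp x u) (y :: z :: l) = 0
    rw [prependOp_cons, prependOp_cons]
    split_ifs with h h'
    · exact absurd (congrArg some h'.1) h.2
    · rfl
    · rfl

/-- A Magnus-type representation of the free group: `of x` acts as the unipotent operator
`1 + prependOp x`. -/
noncomputable def magnus (X : Type*) : FreeGroup X →* (Module.End ℚ (List X → ℚ))ˣ :=
  lift fun x =>
    { val := 1 + prependOp x
      inv := 1 - prependOp x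
      val_inv := by
        rw [add_mul, one_mul, mul_sub, mul_one, prependOp_mul_self]
        simp
      inv_val := by
        rw [sub_mul, one_mul, mul_add, mul_one, prependOp_mul_self]
        simp }

theorem magnus_of (x : X) : (magnus X (of x) : Module.End ℚ (List X → ℚ)) = 1 + prependOp x := by
  simp [magnus]

theorem magnus_of_inv (x : X) :
    (magnus X (of x)⁻¹ : Module.End ℚ (List X → ℚ)) = 1 - prependOp x := by
  rw [_root_.map_inv, magnus, lift_apply_of]
  rfl

/-- The functions vanishing at all words of length less than `n`. -/
def wordFiltration (X : Type*) (n : ℕ) : Submodule ℚ (List X → ℚ) where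
  carrier := {u | ∀ l, l.length < n → u l = 0}
  add_mem' hu hv l hl := by simp [hu l hl, hv l hl]
  zero_mem' _ _ := rfl
  smul_mem' c u hu l hl := by simp [hu l hl]

theorem wordFiltration_succ_le (n : ℕ) : wordFiltration X (n + 1) ≤ wordFiltration X n :=
  fun _ hu l hl => hu l (hl.trans n.lt_succ_self)

theorem prependOp_mem (x : X) {n : ℕ} {u : List X → ℚ} (hu : u ∈ wordFiltration X n) :
    prependOp x u ∈ wordFiltration X (n + 1) := by
  intro l hl
  cases l with
  | nil => rfl
  | cons y l => simp [prependOp_cons, hu l (by simpa using hl)]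

theorem magnus_sub_mem (g : FreeGroup X) : ∀ {n : ℕ} {u : List X → ℚ},
    u ∈ wordFiltration X n →
      (magnus X g : Module.End ℚ (List X → ℚ)) u - u ∈ wordFiltration X (n + 1) := by
  induction g using FreeGroup.induction_on with
  | C1 => intro n u _; simp
  | of x => intro n u hu; simpa [magnus_of] using prependOp_mem x hu
  | inv_of x _ =>
    intro n u hu
    rw [magnus_of_inv]
    simpa using prependOp_mem x hu
  | mul g h ihg ihh =>
    intro n u hu
    have h₁ := ihh hu
    have h₂ : (magnus X h : Module.End ℚ (List X → ℚ)) u ∈ wordFiltration X n := by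
      have := add_mem (wordFiltration_succ_le n h₁) hu
      simpa using this
    have := add_mem (ihg h₂) h₁
    simpa using this

/-- `l` is the unique longest word at which `u` does not vanish. -/
def IsLeadingWord (u : List X → ℚ) (l : List X) : Prop :=
  u l ≠ 0 ∧ ∀ l', l' ≠ l → l.length ≤ l'.length → u l' = 0

theorem IsLeadingWord.add_smul_prependOp {u : List X → ℚ} {l : List X} (h : IsLeadingWord u l)
    {x : X} (hx : l.head? ≠ some x) {c : ℚ} (hc : c ≠ 0) :
    IsLeadingWord (u + c • prependOp x u) (x :: l) := by
  refine ⟨?_, fun l' hne hle => ?_⟩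
  · simpa [prependOp_cons, hx, h.2 (x :: l) (by simp) (by simp)] using ⟨hc, h.1⟩
  · have h₁ : u l' = 0 := h.2 l' (by rintro rfl; simp at hle) (by simp at hle; omega)
    cases l' with
    | nil => simp at hle
    | cons y l' =>
      by_cases hy : y = x
      · subst hy
        simp [h₁, prependOp_cons, h.2 l' (by simpa using hne) (by simpa using hle)]
      · simp [h₁, prependOp_cons, hy]

open Classical in
theorem exists_isLeadingWord_magnus (L : List (X × Bool)) : ∀ (x : X) (b : Bool),
    IsReduced ((x, b) :: L) → ∃ (c : ℚ) (u : List X → ℚ) (l : List X),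
      0 < (if b then c else -c) ∧ IsLeadingWord u l ∧ l.head? ≠ some x ∧
      (magnus X (mk ((x, b) :: L)) : Module.End ℚ (List X → ℚ)) (Pi.single [] 1) =
        u + c • prependOp x u := by
  have hletter (x : X) (b : Bool) : (magnus X (mk [(x, b)]) : Module.End ℚ (List X → ℚ)) =
      1 + (if b then (1 : ℚ) else -1) • prependOp x := by
    cases b
    · rw [show mk [(x, false)] = (of x)⁻¹ from rfl, magnus_of_inv]
      simp only [Bool.false_eq_true, if_false]
      module
    · rw [show mk [(x, true)] = of x from rfl, magnus_of]
      simp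
  induction L with
  | nil =>
    intro x b _
    refine ⟨if b then 1 else -1, Pi.single [] 1, [], by cases b <;> simp, ⟨by simp, ?_⟩,
      by simp, by rw [hletter]; rfl⟩
    intro l' hl' _
    simp [hl']
  | cons p L ih =>
    intro x b hred
    obtain ⟨y, b'⟩ := p
    rw [isReduced_cons_cons] at hred
    obtain ⟨c, u, l, hc, hu, hl, heq⟩ := ih y b' hred.2
    have hc0 : c ≠ 0 := by
      rintro rfl
      simp at hc
    have hsplit : mk ((x, b) :: (y, b') :: L) = mk [(x, b)] * mk ((y, b') :: L) := rfl
    rw [hsplit, _root_.map_mul, Units.val_mul, Module.End.mul_apply, heq, hletter]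
    by_cases hxy : x = y
    · subst hxy
      obtain rfl : b = b' := hred.1 rfl
      refine ⟨c + if b then 1 else -1, u, l, ?_, hu, hl, ?_⟩
      · cases b <;> simp at hc ⊢ <;> linarith
      · have h0 : prependOp x (prependOp x u) = 0 :=
          LinearMap.congr_fun (prependOp_mul_self x) u
        simp only [LinearMap.add_apply, Module.End.one_apply, LinearMap.smul_apply, map_add,
          map_smul, h0]
        module
    · refine ⟨if b then 1 else -1, u + c • prependOp y u, y :: l, by cases b <;> simp,
        hu.add_smul_prependOp hl hc0, by simpa using Ne.symm hxy, rfl⟩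

theorem magnus_injective : Function.Injective (magnus X) := by
  classical
  rw [injective_iff_map_eq_one]
  intro g hg
  rw [← toWord_eq_nil_iff]
  cases hL : g.toWord with
  | nil => rfl
  | cons p L =>
    exfalso
    obtain ⟨x, b⟩ := p
    have hred : IsReduced g.toWord := isReduced_toWord
    obtain ⟨c, u, l, hc, hu, hl, heq⟩ := exists_isLeadingWord_magnus L x b (hL ▸ hred)
    have hc0 : c ≠ 0 := by
      rintro rfl
      simp at hc
    have hlead := hu.add_smul_prependOp hl hc0
    rw [← heq, ← hL, mk_toWord, hg] at hlead
    exact hlead.1 (by simp)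

end Magnus

end FreeGroup

section Augmentation

open MonoidAlgebra

/-- The augmentation ideal of the rational group algebra, as a subspace. -/
noncomputable def augmentationSpan (G : Type*) [Group G] : Submodule ℚ (MonoidAlgebra ℚ G) :=
  Submodule.span ℚ (Set.range fun g : G => of ℚ G g - 1)

variable {G : Type*} [Group G]

theorem of_sub_one_mem_augmentationSpan (g : G) : of ℚ G g - 1 ∈ augmentationSpan G :=
  Submodule.subset_span ⟨g, rfl⟩

theorem augmentationSpan_mul_self_le :
    augmentationSpan G * augmentationSpan G ≤ augmentationSpan G := by
  conv_lhs => rw [augmentationSpan, Submodule.span_mul_span]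
  rw [Submodule.span_le]
  rintro _ ⟨_, ⟨g, rfl⟩, _, ⟨h, rfl⟩, rfl⟩
  have : (of ℚ G g - 1) * (of ℚ G h - 1) =
      (of ℚ G (g * h) - 1) - (of ℚ G g - 1) - (of ℚ G h - 1) := by
    rw [map_mul]
    noncomm_ring
  change (of ℚ G g - 1) * (of ℚ G h - 1) ∈ augmentationSpan G
  rw [this]
  exact sub_mem (sub_mem (of_sub_one_mem_augmentationSpan _) (of_sub_one_mem_augmentationSpan _))
    (of_sub_one_mem_augmentationSpan _)

theorem augmentationSpan_pow_anti {m n : ℕ} (hm : 1 ≤ m) (hmn : m ≤ n) :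
    augmentationSpan G ^ n ≤ augmentationSpan G ^ m := by
  induction n, hmn using Nat.le_induction with
  | base => exact le_rfl
  | succ n hn ih =>
    refine le_trans ?_ ih
    obtain ⟨k, rfl⟩ : ∃ k, n = k + 1 := ⟨n - 1, by omega⟩
    rw [pow_succ _ (k + 1), pow_succ, mul_assoc]
    exact mul_le_mul_right augmentationSpan_mul_self_le _

/-- The homomorphism `g ↦ g - 1` from `G` to the augmentation ideal modulo its square. -/
noncomputable def toAugmentationQuotient (G : Type*) [Group G] :
    G →* Multiplicative (MonoidAlgebra ℚ G ⧸ augmentationSpan G ^ 2) where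
  toFun g := Multiplicative.ofAdd (Submodule.Quotient.mk (of ℚ G g - 1))
  map_one' := by rw [map_one, sub_self, Submodule.Quotient.mk_zero, ofAdd_zero]
  map_mul' g h := by
    rw [← ofAdd_add, ← Submodule.Quotient.mk_add, EmbeddingLike.apply_eq_iff_eq,
      Submodule.Quotient.eq, map_mul]
    have : of ℚ G g * of ℚ G h - 1 - (of ℚ G g - 1 + (of ℚ G h - 1)) =
        (of ℚ G g - 1) * (of ℚ G h - 1) := by
      noncomm_ring
    rw [this, pow_two]
    exact Submodule.mul_mem_mul (of_sub_one_mem_augmentationSpan g)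
      (of_sub_one_mem_augmentationSpan h)

/-- The action of automorphisms of `G` on the group algebra. -/
noncomputable def groupAlgebraMap (β : MulAut G) : MonoidAlgebra ℚ G →ₐ[ℚ] MonoidAlgebra ℚ G :=
  lift ℚ _ G ((of ℚ G).comp β.toMonoidHom)

theorem groupAlgebraMap_of (β : MulAut G) (g : G) :
    groupAlgebraMap β (of ℚ G g) = of ℚ G (β g) := by
  rw [groupAlgebraMap, lift_of]
  rfl

theorem groupAlgebraMap_mem_pow (β : MulAut G) (n : ℕ) {a : MonoidAlgebra ℚ G}
    (ha : a ∈ augmentationSpan G ^ n) : groupAlgebraMap β a ∈ augmentationSpan G ^ n := by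
  have h : (augmentationSpan G).map (groupAlgebraMap β).toLinearMap ≤ augmentationSpan G := by
    rw [augmentationSpan, Submodule.map_span_le]
    rintro _ ⟨g, rfl⟩
    change groupAlgebraMap β (of ℚ G g - 1) ∈ augmentationSpan G
    rw [map_sub, map_one, groupAlgebraMap_of]
    exact of_sub_one_mem_augmentationSpan _
  have hmap := Submodule.mem_map_of_mem (f := (groupAlgebraMap β).toLinearMap) ha
  rw [Submodule.map_pow] at hmap
  exact pow_le_pow_left' h n hmap

/-- If `β` moves the elements of `I` by elements of `I ^ (j + 1)`, then it moves the elements of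
`I ^ i` by elements of `I ^ (i + j)`. -/
theorem groupAlgebraMap_sub_mem_pow {β : MulAut G} {j : ℕ}
    (h : ∀ a ∈ augmentationSpan G, groupAlgebraMap β a - a ∈ augmentationSpan G ^ (1 + j))
    (i : ℕ) {a : MonoidAlgebra ℚ G} (ha : a ∈ augmentationSpan G ^ i) :
    groupAlgebraMap β a - a ∈ augmentationSpan G ^ (i + j) := by
  induction i generalizing a with
  | zero =>
    rw [pow_zero, Submodule.mem_one] at ha
    obtain ⟨r, rfl⟩ := ha
    rw [AlgHom.commutes, sub_self]
    exact zero_mem _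
  | succ i ih =>
    rw [pow_succ'] at ha
    induction ha using Submodule.mul_induction_on' with
    | mem_mul_mem x hx y hy =>
      have key : groupAlgebraMap β (x * y) - x * y =
          (groupAlgebraMap β x - x) * groupAlgebraMap β y + x * (groupAlgebraMap β y - y) := by
        rw [map_mul]
        noncomm_ring
      rw [key]
      refine add_mem ?_ ?_
      · rw [show i + 1 + j = 1 + j + i by omega, pow_add]
        exact Submodule.mul_mem_mul (h x hx) (groupAlgebraMap_mem_pow β i hy)
      · rw [show i + 1 + j = i + j + 1 by omega, pow_succ']
        exact Submodule.mul_mem_mul hx (ih hy)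
    | add x _ y _ hx hy =>
      rw [map_add, add_sub_add_comm]
      exact add_mem hx hy

/-- An automorphism of order two acting trivially on the abelianization acts trivially modulo all
powers of the augmentation ideal. -/
theorem groupAlgebraMap_sub_mem_pow_of_involutive {β : MulAut G} (hβ : β * β = 1)
    (hab : ∀ g, Abelianization.of (β g) = Abelianization.of g) (j : ℕ)
    {a : MonoidAlgebra ℚ G} (ha : a ∈ augmentationSpan G) :
    groupAlgebraMap β a - a ∈ augmentationSpan G ^ (1 + (j + 1)) := by
  induction j generalizing a with
  | zero =>
    induction ha using Submodule.span_induction with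
    | mem _ hx =>
      obtain ⟨g, rfl⟩ := hx
      have h := congrArg (Abelianization.lift (toAugmentationQuotient G)) (hab g)
      rw [Abelianization.lift_apply_of, Abelianization.lift_apply_of] at h
      have h' := (Submodule.Quotient.eq _).mp (Multiplicative.ofAdd.injective h)
      rw [map_sub, map_one, groupAlgebraMap_of]
      exact h'
    | zero => simp
    | add x y _ _ hx hy =>
      rw [map_add, add_sub_add_comm]
      exact add_mem hx hy
    | smul c x _ hx =>
      rw [map_smul, ← smul_sub]
      exact Submodule.smul_mem _ _ hx
  | succ j ih =>
    have hinv (b : MonoidAlgebra ℚ G) : groupAlgebraMap β (groupAlgebraMap β b) = b := by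
      have : (groupAlgebraMap β).comp (groupAlgebraMap β) = AlgHom.id ℚ _ := by
        refine MonoidAlgebra.algHom_ext (fun g => ?_) (Subsingleton.elim _ _)
        change groupAlgebraMap β (groupAlgebraMap β (of ℚ G g)) = of ℚ G g
        rw [groupAlgebraMap_of, groupAlgebraMap_of, ← MulAut.mul_apply, hβ, MulAut.one_apply]
      exact DFunLike.congr_fun this b
    have h₁ := groupAlgebraMap_sub_mem_pow (fun b hb => ih hb) _ (ih ha)
    have h₂ : groupAlgebraMap β a - a = (-(1 / 2) : ℚ) •
        (groupAlgebraMap β (groupAlgebraMap β a - a) - (groupAlgebraMap β a - a)) := by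
      rw [map_sub, hinv]
      module
    rw [h₂]
    exact Submodule.smul_mem _ _ (augmentationSpan_pow_anti (by omega) (by omega) h₁)

end Augmentation

namespace FreeGroup

open MonoidAlgebra

variable {X : Type*}

theorem lift_magnus_mem {n : ℕ} {a : MonoidAlgebra ℚ (FreeGroup X)}
    (ha : a ∈ augmentationSpan (FreeGroup X) ^ n) {m : ℕ} {u : List X → ℚ}
    (hu : u ∈ wordFiltration X m) :
    MonoidAlgebra.lift ℚ (Module.End ℚ (List X → ℚ)) (FreeGroup X)
      ((Units.coeHom _).comp (magnus X)) a u ∈ wordFiltration X (n + m) := by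
  induction n generalizing a with
  | zero =>
    rw [pow_zero, Submodule.mem_one] at ha
    obtain ⟨r, rfl⟩ := ha
    rw [AlgHom.commutes, Module.algebraMap_end_apply, zero_add]
    exact Submodule.smul_mem _ _ hu
  | succ n ih =>
    rw [pow_succ'] at ha
    induction ha using Submodule.mul_induction_on' with
    | mem_mul_mem x hx y hy =>
      rw [_root_.map_mul, Module.End.mul_apply, show n + 1 + m = n + m + 1 by omega]
      have hy' := ih hy
      induction hx using Submodule.span_induction with
      | mem _ hx =>
        obtain ⟨g, rfl⟩ := hx
        rw [map_sub, _root_.map_one, lift_of]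
        exact magnus_sub_mem g hy'
      | zero => simp
      | add x y _ _ hx hy =>
        rw [map_add]
        exact add_mem hx hy
      | smul c x _ hx =>
        rw [map_smul]
        exact Submodule.smul_mem _ _ hx
    | add x _ y _ hx hy =>
      rw [map_add]
      exact add_mem hx hy

theorem eq_of_forall_sub_mem_pow {g h : FreeGroup X}
    (hgh : ∀ n, MonoidAlgebra.of ℚ _ g - MonoidAlgebra.of ℚ _ h ∈
      augmentationSpan (FreeGroup X) ^ (n + 1)) : g = h := by
  refine magnus_injective (Units.ext (LinearMap.ext fun u => funext fun l => ?_))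
  have hu : u ∈ wordFiltration X 0 := fun _ hl => absurd hl (Nat.not_lt_zero _)
  have := lift_magnus_mem (hgh l.length) hu l (by omega)
  rw [map_sub, MonoidAlgebra.lift_of, MonoidAlgebra.lift_of] at this
  exact sub_eq_zero.mp this

/-- The kernel of the action of `Aut F` on the abelianization of `F` has no involutions. -/
theorem eq_one_of_mul_self_eq_one {β : MulAut (FreeGroup X)} (hβ : β * β = 1)
    (hab : ∀ g, Abelianization.of (β g) = Abelianization.of g) : β = 1 := by
  ext g : 1
  refine eq_of_forall_sub_mem_pow fun n => ?_
  have h := groupAlgebraMap_sub_mem_pow_of_involutive hβ hab n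
    (of_sub_one_mem_augmentationSpan g)
  rw [map_sub, groupAlgebraMap_of, _root_.map_one, sub_sub_sub_cancel_right] at h
  exact augmentationSpan_pow_anti (by omega) (by omega) h

end FreeGroup

section Symmetries

open FreeGroup hiding map_mul map_inv map_one flip

variable {X : Type*}

theorem MulAut.mul_conj {G : Type*} [Group G] (φ : MulAut G) (g : G) :
    φ * MulAut.conj g = MulAut.conj (φ g) * φ := by
  ext x
  simp

theorem toOut_eq_one_iff {G : Type*} [Group G] {φ : MulAut G} :
    toOut φ = 1 ↔ ∃ g, MulAut.conj g = φ :=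
  QuotientGroup.eq_one_iff φ

theorem toOut_conj {G : Type*} [Group G] (g : G) : toOut (MulAut.conj g) = 1 :=
  toOut_eq_one_iff.mpr ⟨g, rfl⟩

/-- The parities of the exponents of the generators. -/
noncomputable def exponentParity (X : Type*) :
    FreeGroup X →* Multiplicative (X →₀ ZMod 2) :=
  FreeGroup.lift fun x => Multiplicative.ofAdd (Finsupp.single x 1)

theorem exponentParity_inv (g : FreeGroup X) : (exponentParity X g)⁻¹ = exponentParity X g := by
  refine Multiplicative.toAdd.injective (Finsupp.ext fun x => ?_)
  exact ZMod.neg_eq_self_mod_two _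

theorem exponentParity_apply {σ : MulAut (FreeGroup X)}
    (hab : ∀ g, Abelianization.of (σ g) = (Abelianization.of g)⁻¹) (g : FreeGroup X) :
    exponentParity X (σ g) = exponentParity X g := by
  have h := congrArg (Abelianization.lift (exponentParity X)) (hab g)
  rwa [map_inv, Abelianization.lift_apply_of, Abelianization.lift_apply_of,
    exponentParity_inv] at h

theorem abelianization_flip (g : FreeGroup X) :
    Abelianization.of (FreeGroup.flip X g) = (Abelianization.of g)⁻¹ := by
  have h : Abelianization.of.comp (FreeGroup.flip X).toMonoidHom =
      (Abelianization.of : FreeGroup X →* _)⁻¹ := by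
    ext x
    simp
  exact DFunLike.congr_fun h g

theorem exponentParity_palindrome {d : FreeGroup X} (h : d * FreeGroup.flip X d = 1) :
    (∃ w, d = w * (FreeGroup.flip X w)⁻¹) ∨
      ∃ x, exponentParity X d = Multiplicative.ofAdd (Finsupp.single x 1) := by
  have hparity (w : FreeGroup X) : exponentParity X w * exponentParity X w = 1 := by
    nth_rewrite 2 [← exponentParity_inv w]
    exact mul_inv_cancel _
  have hof (x : X) : exponentParity X (of x) = Multiplicative.ofAdd (Finsupp.single x 1) := by
    simp [exponentParity]
  obtain ⟨w, hw | ⟨x, hw | hw⟩⟩ := exists_eq_of_mul_flip_eq_one h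
  · exact Or.inl ⟨w, hw⟩
  all_goals
    refine Or.inr ⟨x, ?_⟩
    rw [hw]
    simp only [map_mul, map_inv, exponentParity_inv, exponentParity_apply abelianization_flip]
    rw [mul_right_comm, hparity, one_mul, hof]

theorem mul_apply_eq_one_of_mul_self_eq_one [Infinite X] {θ : MulAut (FreeGroup X)}
    (hθ : θ * θ = 1) {d : FreeGroup X}
    (h : (MulAut.conj d * θ) * (MulAut.conj d * θ) = 1) : d * θ d = 1 := by
  refine eq_one_of_conj_eq_one ?_
  rw [mul_assoc, ← mul_assoc θ, MulAut.mul_conj, mul_assoc (MulAut.conj (θ d)), hθ, mul_one] at h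
  rw [map_mul, h]

theorem exists_conj_flip_eq [Infinite X] {σ : MulAut (FreeGroup X)}
    (hab : ∀ g, Abelianization.of (σ g) = (Abelianization.of g)⁻¹)
    (hcomm : toOut (FreeGroup.flip X) * toOut σ = toOut σ * toOut (FreeGroup.flip X)) :
    ∃ w, σ * FreeGroup.flip X * σ⁻¹ = MulAut.conj w * FreeGroup.flip X * (MulAut.conj w)⁻¹ := by
  obtain ⟨d, hd⟩ : ∃ d, MulAut.conj d = σ * FreeGroup.flip X * σ⁻¹ * (FreeGroup.flip X)⁻¹ := by
    rw [← toOut_eq_one_iff]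
    simp [map_mul, map_inv, ← hcomm]
  have hd' : σ * FreeGroup.flip X * σ⁻¹ = MulAut.conj d * FreeGroup.flip X := by rw [hd]; group
  -- Conjugation by `σ` turns the involution `conj b * flip` into `conj (σ b * d) * flip`.
  have hpal (b : FreeGroup X) (hb : b * FreeGroup.flip X b = 1) :
      σ b * d * FreeGroup.flip X (σ b * d) = 1 := by
    refine mul_apply_eq_one_of_mul_self_eq_one flip_mul_flip ?_
    have h₁ : MulAut.conj (σ b * d) * FreeGroup.flip X =
        σ * (MulAut.conj b * FreeGroup.flip X) * σ⁻¹ := by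
      rw [map_mul, mul_assoc, ← hd', ← mul_assoc σ (MulAut.conj b), MulAut.mul_conj]
      group
    have h₂ : (MulAut.conj b * FreeGroup.flip X) * (MulAut.conj b * FreeGroup.flip X) = 1 := by
      rw [mul_assoc, ← mul_assoc (FreeGroup.flip X), MulAut.mul_conj,
        mul_assoc (MulAut.conj (FreeGroup.flip X b)), flip_mul_flip, mul_one, ← map_mul, hb, map_one]
    rw [h₁, ← pow_two, conj_pow, pow_two, h₂]
    group
  have hd₁ : d * FreeGroup.flip X d = 1 := by simpa using hpal 1 (by simp)
  obtain ⟨w, hw⟩ | ⟨x, hx⟩ := exponentParity_palindrome hd₁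
  · refine ⟨w, ?_⟩
    rw [hd', hw, map_mul, map_inv, mul_assoc, mul_assoc]
    congr 1
    rw [← map_inv MulAut.conj w, MulAut.mul_conj, map_inv (FreeGroup.flip X), map_inv]
  · exfalso
    classical
    obtain ⟨y, hy⟩ := exists_ne x
    have hy₁ := hpal (of y) (by simp)
    have hval : exponentParity X (σ (of y) * d) =
        Multiplicative.ofAdd (Finsupp.single y 1 + Finsupp.single x 1) := by
      rw [map_mul, exponentParity_apply hab, hx, ofAdd_add]
      simp [exponentParity]
    obtain ⟨w, hw⟩ | ⟨z, hz⟩ := exponentParity_palindrome hy₁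
    · rw [hw, map_mul, map_inv, exponentParity_apply abelianization_flip, mul_inv_cancel] at hval
      have hval' : (0 : X →₀ ZMod 2) = Finsupp.single y 1 + Finsupp.single x 1 := hval
      have h₁ := DFunLike.congr_fun hval' x
      simp [hy] at h₁
    · rw [hz] at hval
      have hval' : Finsupp.single z (1 : ZMod 2) = Finsupp.single y 1 + Finsupp.single x 1 := hval
      have h₁ := DFunLike.congr_fun hval' x
      have h₂ := DFunLike.congr_fun hval' y
      by_cases hzx : z = x
      · simp [hzx, hy.symm] at h₂
      · simp [hzx, hy] at h₁

theorem toOut_flip_eq_of_commute [Infinite X] {σ : MulAut (FreeGroup X)} (hσ : σ * σ = 1)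
    (hab : ∀ g, Abelianization.of (σ g) = (Abelianization.of g)⁻¹)
    (hcomm : toOut (FreeGroup.flip X) * toOut σ = toOut σ * toOut (FreeGroup.flip X)) :
    toOut (FreeGroup.flip X) = toOut σ := by
  obtain ⟨w, hw⟩ := exists_conj_flip_eq hab hcomm
  obtain ⟨τ, hτ⟩ : ∃ τ, τ = (MulAut.conj w)⁻¹ * σ := ⟨_, rfl⟩
  have hτflip : FreeGroup.flip X * τ = τ * FreeGroup.flip X := by
    have h : τ * FreeGroup.flip X * τ⁻¹ = FreeGroup.flip X := by
      rw [hτ, mul_inv_rev, inv_inv,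
        show (MulAut.conj w)⁻¹ * σ * FreeGroup.flip X * (σ⁻¹ * MulAut.conj w) =
          (MulAut.conj w)⁻¹ * (σ * FreeGroup.flip X * σ⁻¹) * MulAut.conj w by group, hw]
      group
    rw [mul_inv_eq_iff_eq_mul] at h
    exact h.symm
  have hττ : τ * τ = MulAut.conj (w⁻¹ * σ w⁻¹) := by
    rw [hτ, ← map_inv, mul_assoc, ← mul_assoc σ, MulAut.mul_conj, mul_assoc _ σ σ, hσ, mul_one,
      map_mul]
  have hτ1 : τ * τ = 1 := by
    have h : MulAut.conj (FreeGroup.flip X (w⁻¹ * σ w⁻¹)) = MulAut.conj (w⁻¹ * σ w⁻¹) := by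
      rw [← mul_left_inj (FreeGroup.flip X), ← MulAut.mul_conj, ← hττ]
      exact Commute.mul_right hτflip hτflip
    have h' : MulAut.conj (FreeGroup.flip X (w⁻¹ * σ w⁻¹) * (w⁻¹ * σ w⁻¹)⁻¹) = 1 := by
      rw [map_mul, h, ← map_mul, mul_inv_cancel, map_one]
    rw [hττ, eq_one_of_flip_eq (mul_inv_eq_one.mp (eq_one_of_conj_eq_one h')), map_one]
  have hτab (g : FreeGroup X) : Abelianization.of (τ g) = (Abelianization.of g)⁻¹ := by
    rw [hτ, ← map_inv, MulAut.mul_apply, MulAut.conj_apply, map_mul, map_mul,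
      mul_right_comm, ← map_mul, mul_inv_cancel, map_one, one_mul, hab]
  have hβ : FreeGroup.flip X * τ = 1 := by
    refine eq_one_of_mul_self_eq_one ?_ fun g => ?_
    · rw [mul_assoc, ← mul_assoc τ, ← hτflip, mul_assoc, hτ1, mul_one, flip_mul_flip]
    · rw [MulAut.mul_apply, abelianization_flip, hτab, inv_inv]
  have hflip : FreeGroup.flip X = τ := by
    rw [← mul_left_inj τ, hβ, hτ1]
  rw [hflip, hτ, map_mul, map_inv, toOut_conj, inv_one, one_mul]

theorem IsSymmetryAut.exists_eq_conj {θ : MulAut (FreeGroup X)} (hθ : IsSymmetryAut θ) :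
    ∃ φ : MulAut (FreeGroup X), θ = φ * FreeGroup.flip X * φ⁻¹ := by
  obtain ⟨-, B, hB, hinv⟩ := hθ
  let e : FreeGroup B ≃* FreeGroup X := MulEquiv.ofBijective _ hB
  let φ : MulAut (FreeGroup X) := (freeGroupCongr (Equiv.ofFreeGroupEquiv e).symm).trans e
  have hφ (x : X) : φ (of x) ∈ B := by
    change FreeGroup.lift (fun s : B => (s : FreeGroup X)) (freeGroupCongr _ (of x)) ∈ B
    simp
  refine ⟨φ, eq_mul_inv_of_mul_eq (MulEquiv.toMonoidHom_injective ?_)⟩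
  ext x
  change θ (φ (of x)) = φ (FreeGroup.flip X (of x))
  rw [hinv _ (hφ x), flip_of, map_inv]

theorem FreeGroup.IsBasis.image {B : Set (FreeGroup X)} (hB : FreeGroup.IsBasis B)
    (φ : MulAut (FreeGroup X)) : FreeGroup.IsBasis (Set.image φ B) := by
  let e : B ≃ Set.image φ B := φ.toEquiv.image B
  have h : (FreeGroup.lift (fun s : Set.image φ B => (s : FreeGroup X))).comp
      (freeGroupCongr e).toMonoidHom =
      φ.toMonoidHom.comp (FreeGroup.lift (fun s : B => (s : FreeGroup X))) := by
    ext s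
    simp only [MonoidHom.comp_apply, FreeGroup.lift_apply_of]
    change FreeGroup.lift _ (freeGroupCongr e (of s)) = φ s
    rw [freeGroupCongr_apply, FreeGroup.map.of, FreeGroup.lift_apply_of]
    rfl
  have h' : Function.Bijective ((FreeGroup.lift (fun s : Set.image φ B => (s : FreeGroup X))) ∘
      (freeGroupCongr e)) := by
    have := φ.bijective.comp hB
    convert this using 1
    exact congrArg DFunLike.coe h
  exact (Function.Bijective.of_comp_iff _ (freeGroupCongr e).bijective).mp h'

theorem IsInvolution.conj {G : Type*} [Group G] {g : G} (h : IsInvolution g) (c : G) :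
    IsInvolution (c * g * c⁻¹) := by
  refine ⟨fun h1 => h.1 (conj_eq_one_iff.mp h1), ?_⟩
  rw [conj_pow, h.2, mul_one, mul_inv_cancel]

theorem IsSymmetryAut.conj {θ : MulAut (FreeGroup X)} (hθ : IsSymmetryAut θ)
    (φ : MulAut (FreeGroup X)) : IsSymmetryAut (φ * θ * φ⁻¹) := by
  obtain ⟨hi, B, hB, hinv⟩ := hθ
  refine ⟨hi.conj φ, Set.image φ B, hB.image φ, ?_⟩
  rintro _ ⟨b, hb, rfl⟩
  simp [hinv b hb]

theorem isBasis_range_of : FreeGroup.IsBasis (Set.range (of : X → FreeGroup X)) := by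
  let e : X ≃ Set.range (of : X → FreeGroup X) := Equiv.ofInjective _ of_injective
  have h : (FreeGroup.lift (fun s : Set.range (of : X → FreeGroup X) => (s : FreeGroup X))).comp
      (freeGroupCongr e).toMonoidHom = MonoidHom.id _ := by
    ext x
    simp [e]
  refine (Function.Bijective.of_comp_iff _ (freeGroupCongr e).bijective).mp ?_
  convert Function.bijective_id using 1
  exact congrArg DFunLike.coe h

theorem toOut_flip_ne_one [Nonempty X] : toOut (FreeGroup.flip X) ≠ 1 := by
  intro h
  obtain ⟨g, hg⟩ := toOut_eq_one_iff.mp h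
  obtain ⟨x⟩ := ‹Nonempty X›
  let χ : FreeGroup X →* Multiplicative ℤ := FreeGroup.lift fun _ => Multiplicative.ofAdd 1
  have h₁ := congrArg χ (DFunLike.congr_fun hg (of x))
  rw [MulAut.conj_apply, flip_of, map_mul, map_mul, map_inv, map_inv, mul_right_comm,
    mul_inv_cancel, one_mul, FreeGroup.lift_apply_of] at h₁
  have h₂ : (1 : ℤ) = -1 := congrArg Multiplicative.toAdd h₁
  omega

theorem isInvolution_toOut_flip [Nonempty X] : IsInvolution (toOut (FreeGroup.flip X)) :=
  ⟨toOut_flip_ne_one, by rw [pow_two, ← map_mul, flip_mul_flip, map_one]⟩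

theorem isSymmetryAut_flip [Nonempty X] : IsSymmetryAut (FreeGroup.flip X) := by
  refine ⟨⟨fun h => toOut_flip_ne_one (X := X) (by rw [h, map_one]), ?_⟩, _, isBasis_range_of, ?_⟩
  · rw [pow_two, flip_mul_flip]
  · rintro _ ⟨x, rfl⟩
    exact flip_of x

theorem isSymmetryOut_iff [Nonempty X] {f : OutAut (FreeGroup X)} :
    IsSymmetryOut f ↔ IsConj (toOut (FreeGroup.flip X)) f := by
  rw [isConj_iff]
  constructor
  · rintro ⟨-, θ, hθ, rfl⟩
    obtain ⟨φ, rfl⟩ := hθ.exists_eq_conj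
    exact ⟨toOut φ, by simp only [map_mul, map_inv]⟩
  · rintro ⟨c, rfl⟩
    obtain ⟨φ, rfl⟩ := QuotientGroup.mk'_surjective (Inn (FreeGroup X)) c
    exact ⟨isInvolution_toOut_flip.conj _, _, isSymmetryAut_flip.conj φ,
      by simp only [map_mul, map_inv]; rfl⟩

theorem IsSymmetryAut.abelianization_apply {σ : MulAut (FreeGroup X)} (hσ : IsSymmetryAut σ)
    (g : FreeGroup X) : Abelianization.of (σ g) = (Abelianization.of g)⁻¹ := by
  obtain ⟨-, B, hB, hinv⟩ := hσ
  obtain ⟨k, rfl⟩ := hB.2 g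
  have h : (Abelianization.of.comp σ.toMonoidHom).comp
        (FreeGroup.lift (fun s : B => (s : FreeGroup X))) =
      (Abelianization.of.comp (FreeGroup.lift (fun s : B => (s : FreeGroup X))))⁻¹ := by
    ext s
    simp [hinv s.1 s.2]
  exact DFunLike.congr_fun h k

end Symmetries

/-- The symmetries of `Out F` form a single conjugacy class of `Out F`, and this class is
anti-commutative: no two distinct symmetries of `Out F` commute in `Out F`. -/
theorem symmetries_single_anticommutative_class (X : Type*) [Infinite X] :
    (∃ f : OutAut (FreeGroup X), IsSymmetryOut f) ∧
    (∀ f g : OutAut (FreeGroup X), IsSymmetryOut f → IsSymmetryOut g → IsConj f g) ∧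
    (∀ f g : OutAut (FreeGroup X), IsSymmetryOut f → IsConj f g → IsSymmetryOut g) ∧
    AntiCommSet {f : OutAut (FreeGroup X) | IsSymmetryOut f} := by
  refine ⟨⟨_, isSymmetryOut_iff.mpr (IsConj.refl _)⟩, fun f g hf hg => ?_, fun f g hf hfg => ?_, ?_⟩
  · exact (isSymmetryOut_iff.mp hf).symm.trans (isSymmetryOut_iff.mp hg)
  · exact isSymmetryOut_iff.mpr ((isSymmetryOut_iff.mp hf).trans hfg)
  · rintro _ ⟨-, θ, hθ, rfl⟩ _ ⟨-, σ, hσ, rfl⟩ hne hcomm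
    obtain ⟨φ, rfl⟩ := hθ.exists_eq_conj
    have hσ' := hσ.conj φ⁻¹
    have hτ : σ = φ * (φ⁻¹ * σ * φ⁻¹⁻¹) * φ⁻¹ := by group
    generalize φ⁻¹ * σ * φ⁻¹⁻¹ = τ at hτ hσ'
    subst hτ
    refine hne ?_
    rw [← map_mul, ← map_mul,
      show φ * FreeGroup.flip X * φ⁻¹ * (φ * τ * φ⁻¹) = φ * (FreeGroup.flip X * τ) * φ⁻¹ by group,
      show φ * τ * φ⁻¹ * (φ * FreeGroup.flip X * φ⁻¹) = φ * (τ * FreeGroup.flip X) * φ⁻¹ by group]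
      at hcomm
    simp only [map_mul, mul_left_inj, mul_right_inj] at hcomm
    have := toOut_flip_eq_of_commute (by rw [← pow_two, hσ'.1.2]) hσ'.abelianization_apply hcomm
    rw [map_mul, map_mul, map_mul, map_mul, this]
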